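/- arXiv:1912.02515 — 4 statements merged into one kernel-verified Lean document; each statement's English description precedes it below -/
import Mathlib

section
/- Let X be a Rado complex and let Y be the simplicial complex obtained from X by selecting a finite set F ⊆ F(X) of simplexes and deleting all simplexes σ ∈ F(X) which contain some simplex from F as a face (i.e. Y has as simplexes all σ ∈ F(X) such that no element of F is a subset of σ). Then Y is a Rado complex. -/
/-- An (abstract) simplicial complex with vertices drawn from `ℕ`:
a set of nonempty finite subsets of `ℕ` (the simplexes) closed under
passing to nonempty subsets.  The vertex set `V(X)` is the set of `v`
with `{v}` a simplex. -/
structure SComplex where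
  faces : Set (Finset ℕ)
  nonempty_of_mem : ∀ s ∈ faces, s.Nonempty
  down_closed : ∀ s ∈ faces, ∀ t ⊆ s, t.Nonempty → t ∈ faces

namespace SComplex

/-- The vertex set of a simplicial complex. -/
def vertexSet (X : SComplex) : Set ℕ := {v | {v} ∈ X.faces}

/-- The subcomplex of `X` induced on a set `U` of vertices. -/
def induced (X : SComplex) (U : Set ℕ) : SComplex where
  faces := {s | s ∈ X.faces ∧ (↑s : Set ℕ) ⊆ U}
  nonempty_of_mem := fun s hs => X.nonempty_of_mem s hs.1
  down_closed := fun s hs t hts ht =>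
    ⟨X.down_closed s hs.1 t hts ht,
     fun x hx => hs.2 (Finset.mem_coe.mpr (hts (Finset.mem_coe.mp hx)))⟩

/-- The link of a vertex `v`: all simplexes `σ` with `v ∉ σ` and `σ ∪ {v}` a simplex. -/
def link (X : SComplex) (v : ℕ) : SComplex where
  faces := {s | s ∈ X.faces ∧ v ∉ s ∧ insert v s ∈ X.faces}
  nonempty_of_mem := fun s hs => X.nonempty_of_mem s hs.1
  down_closed := fun s hs t hts ht =>
    ⟨X.down_closed s hs.1 t hts ht,
     fun hv => hs.2.1 (hts hv),
     X.down_closed _ hs.2.2 _ (Finset.insert_subset_insert v hts)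
       (Finset.insert_nonempty v t)⟩

/-- `IsIso X Y f` : the map `f` is an isomorphism of simplicial complexes from `X` to `Y`,
i.e. a bijection of the vertex sets which induces a bijection between the sets of simplexes. -/
def IsIso (X Y : SComplex) (f : ℕ → ℕ) : Prop :=
  Set.BijOn f X.vertexSet Y.vertexSet ∧
    ∀ s : Finset ℕ, (↑s : Set ℕ) ⊆ X.vertexSet → (s ∈ X.faces ↔ s.image f ∈ Y.faces)

/-- Two simplicial complexes are isomorphic. -/
def Isomorphic (X Y : SComplex) : Prop := ∃ f, IsIso X Y f

/-- `X` is universal: every countable simplicial complex is isomorphic to an induced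
subcomplex of `X`. -/
def Universal (X : SComplex) : Prop :=
  ∀ Y : SComplex, Y.vertexSet.Countable →
    ∃ U ⊆ X.vertexSet, Isomorphic Y (X.induced U)

/-- `X` is homogeneous: every isomorphism between finite induced subcomplexes of `X`
extends to an isomorphism of `X` onto itself. -/
def Homogeneous (X : SComplex) : Prop :=
  ∀ U U' : Set ℕ, U.Finite → U'.Finite → U ⊆ X.vertexSet → U' ⊆ X.vertexSet →
    ∀ f : ℕ → ℕ, IsIso (X.induced U) (X.induced U') f →
      ∃ F : ℕ → ℕ, IsIso X X F ∧ Set.EqOn F f U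

/-- A Rado complex: a countable simplicial complex which is universal and homogeneous. -/
def IsRado (X : SComplex) : Prop :=
  X.vertexSet.Countable ∧ Universal X ∧ Homogeneous X

/-- The ampleness condition: for every finite `U ⊆ V(X)` and every subcomplex `A` of the
induced complex `X_U` there is a vertex `v ∈ V(X) - U` with `Lk_X(v) ∩ X_U = A`. -/
def AmpleProp (X : SComplex) : Prop :=
  ∀ U : Set ℕ, U.Finite → U ⊆ X.vertexSet →
    ∀ A : SComplex, A.faces ⊆ (X.induced U).faces →
      ∃ v ∈ X.vertexSet \ U, (X.link v).faces ∩ (X.induced U).faces = A.faces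

/-- An ample complex: a countable simplicial complex satisfying the ampleness condition. -/
def IsAmple (X : SComplex) : Prop := X.vertexSet.Countable ∧ AmpleProp X

/-- `L'` is an induced subcomplex of `L`. -/
def IsInduced (L' L : SComplex) : Prop :=
  L'.faces ⊆ L.faces ∧ ∀ s ∈ L.faces, (↑s : Set ℕ) ⊆ L'.vertexSet → s ∈ L'.faces

end SComplex

/-- The complex obtained from `X` by deleting all simplexes containing a member of `S`
as a face. -/
def SComplex.delete (X : SComplex) (S : Set (Finset ℕ)) : SComplex where
  faces := {σ | σ ∈ X.faces ∧ ∀ τ ∈ S, ¬ τ ⊆ σ}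
  nonempty_of_mem := fun s hs => X.nonempty_of_mem s hs.1
  down_closed := fun s hs t hts ht =>
    ⟨X.down_closed s hs.1 t hts ht, fun τ hτ hsub => hs.2 τ hτ (hsub.trans hts)⟩

namespace SComplex

lemma mem_vertexSet_of_mem {X : SComplex} {s : Finset ℕ} (hs : s ∈ X.faces) {a : ℕ}
    (ha : a ∈ s) : a ∈ X.vertexSet :=
  X.down_closed s hs {a} (Finset.singleton_subset_iff.2 ha) (Finset.singleton_nonempty a)

lemma vertexSet_induced {X : SComplex} {U : Set ℕ} (hU : U ⊆ X.vertexSet) :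
    (X.induced U).vertexSet = U := by
  ext a
  constructor
  · rintro ⟨-, h⟩
    exact h (by simp)
  · intro ha
    exact ⟨hU ha, by simpa using ha⟩

/-- The complex obtained from the induced complex `X_U` by attaching a cone with apex `w`
over the subcomplex `A`. -/
def attachCone (X : SComplex) (U : Set ℕ) (A : SComplex) (w : ℕ) : SComplex where
  faces := {s | s.Nonempty ∧ (s.erase w ∈ (X.induced U).faces ∨ s.erase w = ∅) ∧
    (w ∈ s → s.erase w ∈ A.faces ∨ s.erase w = ∅)}
  nonempty_of_mem := fun _ hs => hs.1
  down_closed := by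
    rintro s ⟨-, h₁, h₂⟩ t hts ht
    have key : ∀ B : SComplex, s.erase w ∈ B.faces ∨ s.erase w = ∅ →
        t.erase w ∈ B.faces ∨ t.erase w = ∅ := by
      intro B hB
      rcases (t.erase w).eq_empty_or_nonempty with h | h
      · exact Or.inr h
      have hsub : t.erase w ⊆ s.erase w := Finset.erase_subset_erase w hts
      rcases hB with hB | hB
      · exact Or.inl (B.down_closed _ hB _ hsub h)
      · rw [hB, Finset.subset_empty] at hsub
        exact Or.inr hsub
    exact ⟨ht, key _ h₁, fun hw => key A (h₂ (hts hw))⟩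

lemma mem_attachCone_of_notMem {X : SComplex} {U : Set ℕ} {A : SComplex} {w : ℕ}
    {s : Finset ℕ} (hw : w ∉ s) :
    s ∈ (X.attachCone U A w).faces ↔ s ∈ (X.induced U).faces := by
  simp only [attachCone, Set.mem_ofPred_eq, Finset.erase_eq_of_notMem hw, hw, false_imp_iff,
    and_true]
  constructor
  · rintro ⟨h, h' | rfl⟩
    · exact h'
    · simp at h
  · exact fun h => ⟨nonempty_of_mem _ _ h, Or.inl h⟩

lemma insert_mem_attachCone {X : SComplex} {U : Set ℕ} {A : SComplex} {w : ℕ}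
    (hA : A.faces ⊆ (X.induced U).faces) {s : Finset ℕ} (hw : w ∉ s) :
    insert w s ∈ (X.attachCone U A w).faces ↔ s ∈ A.faces ∨ s = ∅ := by
  simp only [attachCone, Set.mem_ofPred_eq, Finset.erase_insert hw, Finset.mem_insert_self,
    true_imp_iff, Finset.insert_nonempty, true_and, and_iff_right_iff_imp]
  exact Or.imp_left (@hA s)

lemma IsIso.restrict_inv {Z X : SComplex} {W U : Set ℕ} {g : ℕ → ℕ} (hW : W ⊆ X.vertexSet)
    (hg : IsIso Z (X.induced W) g) (hU : U ⊆ X.vertexSet) (hUZ : U ⊆ Z.vertexSet)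
    (hface : ∀ s : Finset ℕ, (↑s : Set ℕ) ⊆ U → (s ∈ Z.faces ↔ s ∈ X.faces)) :
    g '' U ⊆ X.vertexSet ∧
      IsIso (X.induced (g '' U)) (X.induced U) (Function.invFunOn g U) := by
  have hinj : Set.InjOn g U := hg.1.injOn.mono hUZ
  have hinv : Set.LeftInvOn (Function.invFunOn g U) g U := hinj.leftInvOn_invFunOn
  have hgW : g '' U ⊆ W := by
    rintro _ ⟨a, ha, rfl⟩
    simpa [vertexSet_induced hW] using hg.1.mapsTo (hUZ ha)
  refine ⟨hgW.trans hW, ?_⟩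
  rw [IsIso, vertexSet_induced (hgW.trans hW), vertexSet_induced hU]
  refine ⟨⟨?_, ?_, ?_⟩, ?_⟩
  · rintro _ ⟨a, ha, rfl⟩
    rwa [hinv ha]
  · rintro _ ⟨a, ha, rfl⟩ _ ⟨b, hb, rfl⟩ h
    rw [hinv ha, hinv hb] at h
    rw [h]
  · exact fun a ha => ⟨g a, ⟨a, ha, rfl⟩, hinv ha⟩
  · intro s hs
    obtain ⟨t, ht, rfl⟩ := Finset.subset_set_image_iff.1 hs
    have h₁ : (t.image g).image (Function.invFunOn g U) = t := by
      rw [Finset.image_image]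
      conv_rhs => rw [← Finset.image_id (s := t)]
      exact Finset.image_congr fun a ha => hinv (ht ha)
    have h₂ := hg.2 t (ht.trans hUZ)
    rw [hface t ht] at h₂
    have h₃ : (↑(t.image g) : Set ℕ) ⊆ W := hs.trans hgW
    rw [h₁]
    simp only [induced, Set.mem_ofPred_eq, hs, ht, h₃, and_true] at h₂ ⊢
    exact h₂.symm

theorem IsRado.ampleProp {X : SComplex} (hX : X.IsRado) : X.AmpleProp := by
  intro U hfin hU A hA
  obtain ⟨w, hw⟩ := hfin.infinite_compl.nonempty
  set Z := X.attachCone U A w with hZ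
  have hwZ : w ∈ Z.vertexSet := by
    have := (insert_mem_attachCone (w := w) hA (Finset.notMem_empty w)).2 (Or.inr rfl)
    simpa [vertexSet] using this
  have hnot : ∀ s : Finset ℕ, (↑s : Set ℕ) ⊆ U → w ∉ s := fun s hs h => hw (hs h)
  have hface : ∀ s : Finset ℕ, (↑s : Set ℕ) ⊆ U → (s ∈ Z.faces ↔ s ∈ X.faces) := by
    intro s hs
    rw [hZ, mem_attachCone_of_notMem (hnot s hs)]
    exact and_iff_left hs
  have hUZ : U ⊆ Z.vertexSet := fun a ha => (hface {a} (by simpa using ha)).2 (hU ha)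
  obtain ⟨W, hW, g, hg⟩ := hX.2.1 Z (Set.to_countable _)
  obtain ⟨hgU, hiso⟩ := hg.restrict_inv hW hU hUZ hface
  obtain ⟨F, hF, hFeq⟩ := hX.2.2 _ _ (hfin.image g) hfin hgU hU _ hiso
  have hinv : Set.LeftInvOn (Function.invFunOn g U) g U :=
    (hg.1.injOn.mono hUZ).leftInvOn_invFunOn
  have hFg : ∀ a ∈ U, F (g a) = a := fun a ha =>
    (hFeq (Set.mem_image_of_mem g ha)).trans (hinv ha)
  have hgV : Set.MapsTo g Z.vertexSet X.vertexSet := fun a ha =>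
    hW (by simpa [vertexSet_induced hW] using hg.1.mapsTo ha)
  have hFgw : F (g w) ∉ U := by
    intro h
    have h₁ := hF.1.injOn (hgV hwZ) (hgV (hUZ h)) (hFg _ h).symm
    exact hw (hg.1.injOn hwZ (hUZ h) h₁ ▸ h)
  have hcone : ∀ s : Finset ℕ, (↑s : Set ℕ) ⊆ U →
      (insert (F (g w)) s ∈ X.faces ↔ s ∈ A.faces ∨ s = ∅) := by
    intro s hs
    have hsub : (↑(insert w s) : Set ℕ) ⊆ Z.vertexSet := by
      rw [Finset.coe_insert]
      exact Set.insert_subset hwZ (hs.trans hUZ)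
    have himg : ((insert w s).image g).image F = insert (F (g w)) s := by
      rw [Finset.image_insert, Finset.image_insert, Finset.image_image]
      congr 1
      conv_rhs => rw [← Finset.image_id (s := s)]
      exact Finset.image_congr fun a ha => hFg a (hs ha)
    have hgs : (↑((insert w s).image g) : Set ℕ) ⊆ W := by
      rw [Finset.coe_image]
      rintro _ ⟨a, ha, rfl⟩
      simpa [vertexSet_induced hW] using hg.1.mapsTo (hsub ha)
    rw [← insert_mem_attachCone hA (hnot s hs), ← hZ, hg.2 _ hsub, ← himg,
      ← hF.2 _ (hgs.trans hW)]
    exact (and_iff_left hgs).symm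
  refine ⟨F (g w), ⟨hF.1.mapsTo (hgV hwZ), hFgw⟩, ?_⟩
  ext s
  constructor
  · rintro ⟨⟨hs, -, hins⟩, -, hsU⟩
    exact ((hcone s hsU).1 hins).resolve_right (X.nonempty_of_mem s hs).ne_empty
  · intro hs
    have hsU := hA hs
    exact ⟨⟨hsU.1, fun h => hFgw (hsU.2 h), (hcone s hsU.2).2 (Or.inl hs)⟩, hsU⟩

theorem AmpleProp.delete {X : SComplex} (hX : X.AmpleProp) {S : Set (Finset ℕ)}
    (hfin : S.Finite) (hS : S ⊆ X.faces) : (X.delete S).AmpleProp := by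
  intro U hU hUV A hA
  set T : Set ℕ := U ∪ ⋃ τ ∈ S, (↑τ : Set ℕ)
  have hST : ∀ τ ∈ S, ∀ a ∈ τ, a ∈ T := fun τ hτ a ha =>
    Or.inr (Set.mem_biUnion hτ (Finset.mem_coe.2 ha))
  have hTfin : T.Finite := hU.union (hfin.biUnion fun τ _ => τ.finite_toSet)
  have hTV : T ⊆ X.vertexSet := by
    rintro a (ha | ha)
    · exact (hUV ha).1
    · obtain ⟨τ, hτ, ha⟩ := Set.mem_iUnion₂.1 ha
      exact mem_vertexSet_of_mem (hS hτ) ha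
  have hAT : A.faces ⊆ (X.induced T).faces := fun s hs =>
    ⟨(hA hs).1.1, (hA hs).2.trans Set.subset_union_left⟩
  obtain ⟨v, ⟨hvX, hvT⟩, hv⟩ := hX T hTfin hTV A hAT
  refine ⟨v, ⟨⟨hvX, ?_⟩, fun h => hvT (Or.inl h)⟩, ?_⟩
  · intro τ hτ hsub
    obtain ⟨a, ha⟩ := X.nonempty_of_mem τ (hS hτ)
    exact hvT (Finset.mem_singleton.1 (hsub ha) ▸ hST τ hτ a ha)
  · ext s
    constructor
    · rintro ⟨⟨hs, hvs, hins⟩, -, hsU⟩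
      rw [← hv]
      exact ⟨⟨hs.1, hvs, hins.1⟩, hs.1, hsU.trans Set.subset_union_left⟩
    · intro hs
      have hs' := hs
      rw [← hv] at hs'
      obtain ⟨⟨-, hvs, hins⟩, -⟩ := hs'
      refine ⟨⟨(hA hs).1, hvs, hins, ?_⟩, hA hs⟩
      intro τ hτ hsub
      refine (hA hs).1.2 τ hτ fun a ha => ?_
      exact (Finset.mem_insert.1 (hsub ha)).resolve_left fun h => hvT (h ▸ hST τ hτ a ha)

/-- A relation `P` between the vertices of `X` and those of `Y` is a partial isomorphism if it
is the graph of an isomorphism between induced subcomplexes of `X` and `Y`. -/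
structure IsPartialIso (X Y : SComplex) (P : Set (ℕ × ℕ)) : Prop where
  fst_mem : ∀ x ∈ P, x.1 ∈ X.vertexSet
  snd_mem : ∀ x ∈ P, x.2 ∈ Y.vertexSet
  fst_eq_iff : ∀ x ∈ P, ∀ y ∈ P, x.1 = y.1 ↔ x.2 = y.2
  mem_faces_iff : ∀ q : Finset (ℕ × ℕ), (↑q : Set (ℕ × ℕ)) ⊆ P →
    (q.image Prod.fst ∈ X.faces ↔ q.image Prod.snd ∈ Y.faces)

namespace IsPartialIso

variable {X Y : SComplex} {P : Set (ℕ × ℕ)}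

lemma empty (X Y : SComplex) : IsPartialIso X Y ∅ where
  fst_mem := by simp
  snd_mem := by simp
  fst_eq_iff := by simp
  mem_faces_iff := by
    intro q hq
    obtain rfl : q = ∅ := by simpa using hq
    exact ⟨fun h => by simpa using X.nonempty_of_mem _ h,
      fun h => by simpa using Y.nonempty_of_mem _ h⟩

lemma swap (hP : IsPartialIso X Y P) : IsPartialIso Y X (Prod.swap ⁻¹' P) where
  fst_mem := fun x hx => hP.snd_mem _ hx
  snd_mem := fun x hx => hP.fst_mem _ hx
  fst_eq_iff := fun x hx y hy => (hP.fst_eq_iff _ hx _ hy).symm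
  mem_faces_iff := by
    intro q hq
    have h := hP.mem_faces_iff (q.image Prod.swap) (by
      rw [Finset.coe_image]
      rintro _ ⟨x, hx, rfl⟩
      exact hq hx)
    simpa [Finset.image_image, Function.comp_def] using h.symm

lemma injOn_snd (hP : IsPartialIso X Y P) : Set.InjOn Prod.snd P := fun x hx y hy h =>
  Prod.ext ((hP.fst_eq_iff x hx y hy).2 h) h

/-- The complex of those sets of second coordinates of `P` whose preimages under `P` span
a simplex together with `a`. -/
def linkImage (X : SComplex) (P : Set (ℕ × ℕ)) (a : ℕ) : SComplex where
  faces := {t | ∃ q : Finset (ℕ × ℕ), (↑q : Set (ℕ × ℕ)) ⊆ P ∧ q.Nonempty ∧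
    insert a (q.image Prod.fst) ∈ X.faces ∧ q.image Prod.snd = t}
  nonempty_of_mem := by
    rintro _ ⟨q, -, hq, -, rfl⟩
    exact hq.image _
  down_closed := by
    rintro _ ⟨q, hqP, -, hface, rfl⟩ t hts ht
    obtain ⟨r, hrq, rfl⟩ := Finset.subset_image_iff.1 hts
    refine ⟨r, (Finset.coe_subset.2 hrq).trans hqP, Finset.image_nonempty.1 ht,
      X.down_closed _ hface _ ?_ (Finset.insert_nonempty _ _), rfl⟩
    exact Finset.insert_subset_insert a (Finset.image_subset_image hrq)

lemma image_snd_mem_linkImage (hP : IsPartialIso X Y P) (a : ℕ) {q : Finset (ℕ × ℕ)}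
    (hq : (↑q : Set (ℕ × ℕ)) ⊆ P) (hne : q.Nonempty) :
    q.image Prod.snd ∈ (linkImage X P a).faces ↔ insert a (q.image Prod.fst) ∈ X.faces := by
  constructor
  · rintro ⟨r, hr, -, hface, heq⟩
    have : r = q := by
      apply Finset.coe_injective
      rw [← hP.injOn_snd.image_eq_image_iff hr hq]
      exact_mod_cast heq
    rwa [← this]
  · exact fun h => ⟨q, hq, hne, h, rfl⟩

lemma exists_extend_fst (hY : Y.AmpleProp) (hfin : P.Finite) (hP : IsPartialIso X Y P)
    {a : ℕ} (ha : a ∈ X.vertexSet) :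
    ∃ P', P ⊆ P' ∧ P'.Finite ∧ IsPartialIso X Y P' ∧ ∃ b, (a, b) ∈ P' := by
  by_cases hdom : ∃ b, (a, b) ∈ P
  · exact ⟨P, subset_rfl, hfin, hP, hdom⟩
  have hA : (linkImage X P a).faces ⊆ (Y.induced (Prod.snd '' P)).faces := by
    rintro _ ⟨q, hq, hne, hface, rfl⟩
    refine ⟨(hP.mem_faces_iff q hq).1 ?_, ?_⟩
    · exact X.down_closed _ hface _ (Finset.subset_insert _ _) (hne.image _)
    · rw [Finset.coe_image]
      exact Set.image_mono hq
  have hsnd : Prod.snd '' P ⊆ Y.vertexSet := by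
    rintro _ ⟨x, hx, rfl⟩
    exact hP.snd_mem x hx
  obtain ⟨v, ⟨hvY, hv⟩, hlink⟩ := hY _ (hfin.image _) hsnd _ hA
  have hfst_ne : ∀ x ∈ P, x.1 ≠ a := fun x hx h => hdom ⟨x.2, h ▸ hx⟩
  have hsnd_ne : ∀ x ∈ P, x.2 ≠ v := fun x hx h => hv ⟨x, hx, h⟩
  refine ⟨insert (a, v) P, Set.subset_insert _ _, hfin.insert _, ⟨?_, ?_, ?_, ?_⟩,
    v, Set.mem_insert _ _⟩
  · rintro x (rfl | hx)
    exacts [ha, hP.fst_mem x hx]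
  · rintro x (rfl | hx)
    exacts [hvY, hP.snd_mem x hx]
  · rintro x (rfl | hx) y (rfl | hy)
    · simp
    · simp [(hfst_ne y hy).symm, (hsnd_ne y hy).symm]
    · simp [hfst_ne x hx, hsnd_ne x hx]
    · exact hP.fst_eq_iff x hx y hy
  · intro q hq
    by_cases hmem : (a, v) ∈ q
    · have hr : (↑(q.erase (a, v)) : Set (ℕ × ℕ)) ⊆ P := by
        rw [Finset.coe_erase]
        rintro x ⟨hx, hne⟩
        exact (hq hx).resolve_left hne
      rw [← Finset.insert_erase hmem]
      generalize q.erase (a, v) = r at hr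
      rw [Finset.image_insert, Finset.image_insert]
      rcases r.eq_empty_or_nonempty with rfl | hne
      · exact iff_of_true ha hvY
      rw [← hP.image_snd_mem_linkImage a hr hne, ← hlink]
      constructor
      · exact fun h => h.1.2.2
      · intro h
        have hface : r.image Prod.snd ∈ Y.faces :=
          Y.down_closed _ h _ (Finset.subset_insert _ _) (hne.image _)
        have hsub : (↑(r.image Prod.snd) : Set ℕ) ⊆ Prod.snd '' P := by
          rw [Finset.coe_image]
          exact Set.image_mono hr
        exact ⟨⟨hface, fun hvr => hv (hsub hvr), h⟩, hface, hsub⟩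
    · refine hP.mem_faces_iff q fun x hx => (hq hx).resolve_left ?_
      rintro rfl
      exact hmem hx

lemma exists_extend_snd (hX : X.AmpleProp) (hfin : P.Finite) (hP : IsPartialIso X Y P)
    {b : ℕ} (hb : b ∈ Y.vertexSet) :
    ∃ P', P ⊆ P' ∧ P'.Finite ∧ IsPartialIso X Y P' ∧ ∃ a, (a, b) ∈ P' := by
  obtain ⟨Q, hPQ, hQfin, hQ, a, ha⟩ :=
    hP.swap.exists_extend_fst hX (hfin.preimage Prod.swap_injective.injOn) hb
  exact ⟨Prod.swap ⁻¹' Q, fun x hx => hPQ (by simpa using hx),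
    hQfin.preimage Prod.swap_injective.injOn, hQ.swap, a, ha⟩

lemma iUnion {P : ℕ → Set (ℕ × ℕ)} (hmono : Monotone P)
    (hP : ∀ n, IsPartialIso X Y (P n)) : IsPartialIso X Y (⋃ n, P n) where
  fst_mem := fun x hx => by
    obtain ⟨n, hn⟩ := Set.mem_iUnion.1 hx
    exact (hP n).fst_mem x hn
  snd_mem := fun x hx => by
    obtain ⟨n, hn⟩ := Set.mem_iUnion.1 hx
    exact (hP n).snd_mem x hn
  fst_eq_iff := fun x hx y hy => by
    obtain ⟨m, hm⟩ := Set.mem_iUnion.1 hx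
    obtain ⟨n, hn⟩ := Set.mem_iUnion.1 hy
    exact (hP (max m n)).fst_eq_iff x (hmono (le_max_left m n) hm) y
      (hmono (le_max_right m n) hn)
  mem_faces_iff := fun q hq => by
    obtain ⟨n, hn⟩ := hmono.directed_le.exists_mem_subset_of_finset_subset_biUnion hq
    exact (hP n).mem_faces_iff q hn

/-- If each of countably many requirements can be met by enlarging finite partial isomorphisms,
then all of them are met simultaneously inside one partial isomorphism. -/
lemma exists_forall {R : ℕ → Set (ℕ × ℕ) → Prop} (hfin : P.Finite) (hP : IsPartialIso X Y P)
    (hR : ∀ n Q, Q.Finite → IsPartialIso X Y Q →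
      ∃ Q', Q ⊆ Q' ∧ Q'.Finite ∧ IsPartialIso X Y Q' ∧ R n Q') :
    ∃ Q, P ⊆ Q ∧ IsPartialIso X Y Q ∧ ∀ n, ∃ Q' ⊆ Q, R n Q' := by
  choose! next hsub hnfin hiso hreq using hR
  let seq : ℕ → Set (ℕ × ℕ) := fun n => Nat.rec P next n
  have hseq : ∀ n, (seq n).Finite ∧ IsPartialIso X Y (seq n) := by
    intro n
    induction n with
    | zero => exact ⟨hfin, hP⟩
    | succ n ih => exact ⟨hnfin n _ ih.1 ih.2, hiso n _ ih.1 ih.2⟩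
  have hmono : Monotone seq :=
    monotone_nat_of_le_succ fun n => hsub n _ (hseq n).1 (hseq n).2
  exact ⟨⋃ n, seq n, Set.subset_iUnion seq 0, iUnion hmono fun n => (hseq n).2, fun n =>
    ⟨seq (n + 1), Set.subset_iUnion seq (n + 1), hreq n _ (hseq n).1 (hseq n).2⟩⟩

lemma isIso_of_graph (hP : IsPartialIso X Y P) {F : ℕ → ℕ}
    (hF : ∀ a ∈ X.vertexSet, (a, F a) ∈ P) : IsIso X (Y.induced (Prod.snd '' P)) F := by
  have hsnd : Prod.snd '' P ⊆ Y.vertexSet := by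
    rintro _ ⟨x, hx, rfl⟩
    exact hP.snd_mem x hx
  rw [IsIso, vertexSet_induced hsnd]
  refine ⟨⟨fun a ha => ⟨_, hF a ha, rfl⟩, fun a ha b hb h => ?_, ?_⟩, fun s hs => ?_⟩
  · exact (hP.fst_eq_iff _ (hF a ha) _ (hF b hb)).2 h
  · rintro _ ⟨x, hx, rfl⟩
    have hx₁ := hP.fst_mem x hx
    exact ⟨x.1, hx₁, (hP.fst_eq_iff _ (hF x.1 hx₁) x hx).1 rfl⟩
  · have h := hP.mem_faces_iff (s.image fun a => (a, F a)) (by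
      rw [Finset.coe_image]
      rintro _ ⟨a, ha, rfl⟩
      exact hF a (hs ha))
    simp only [Finset.image_image, Function.comp_def, Finset.image_id'] at h
    rw [h]
    refine (and_iff_left ?_).symm
    rw [Finset.coe_image]
    rintro _ ⟨a, ha, rfl⟩
    exact ⟨_, hF a (hs ha), rfl⟩

end IsPartialIso

lemma IsIso.isPartialIso {X Y : SComplex} {U U' : Set ℕ} (hU : U ⊆ X.vertexSet)
    (hU' : U' ⊆ Y.vertexSet) {f : ℕ → ℕ} (hf : IsIso (X.induced U) (Y.induced U') f) :
    IsPartialIso X Y ((fun a => (a, f a)) '' U) := by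
  rw [IsIso, vertexSet_induced hU, vertexSet_induced hU'] at hf
  refine ⟨?_, ?_, ?_, ?_⟩
  · rintro _ ⟨a, ha, rfl⟩
    exact hU ha
  · rintro _ ⟨a, ha, rfl⟩
    exact hU' (hf.1.mapsTo ha)
  · rintro _ ⟨a, ha, rfl⟩ _ ⟨b, hb, rfl⟩
    exact (hf.1.injOn.eq_iff ha hb).symm
  · intro q hq
    obtain ⟨s, hs, rfl⟩ := Finset.subset_set_image_iff.1 hq
    have h := hf.2 s hs
    have hs' : (↑(s.image f) : Set ℕ) ⊆ U' := by
      rw [Finset.coe_image]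
      exact (Set.image_mono hs).trans hf.1.mapsTo.image_subset
    simp only [induced, Set.mem_ofPred_eq, hs, hs', and_true] at h
    simpa only [Finset.image_image, Function.comp_def, Finset.image_id'] using h

theorem AmpleProp.universal {X : SComplex} (hX : X.AmpleProp) : X.Universal := by
  intro Y _
  obtain ⟨P, -, hP, hreq⟩ := (IsPartialIso.empty Y X).exists_forall
    (R := fun n Q => n ∈ Y.vertexSet → ∃ b, (n, b) ∈ Q) Set.finite_empty (by
      intro n Q hfin hQ
      by_cases hn : n ∈ Y.vertexSet
      · obtain ⟨Q', h₁, h₂, h₃, h₄⟩ := hQ.exists_extend_fst hX hfin hn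
        exact ⟨Q', h₁, h₂, h₃, fun _ => h₄⟩
      · exact ⟨Q, subset_rfl, hfin, hQ, fun h => absurd h hn⟩)
  have hdom : ∀ a ∈ Y.vertexSet, ∃ b, (a, b) ∈ P := by
    intro a ha
    obtain ⟨Q, hQP, hQ⟩ := hreq a
    exact (hQ ha).imp fun b hb => hQP hb
  choose! F hF using hdom
  refine ⟨Prod.snd '' P, ?_, F, hP.isIso_of_graph hF⟩
  rintro _ ⟨x, hx, rfl⟩
  exact hP.snd_mem x hx

theorem AmpleProp.homogeneous {X : SComplex} (hX : X.AmpleProp) : X.Homogeneous := by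
  intro U U' hfin _ hU hU' f hf
  obtain ⟨P, hfP, hP, hreq⟩ := (hf.isPartialIso hU hU').exists_forall
    (R := fun n Q => n ∈ X.vertexSet → (∃ b, (n, b) ∈ Q) ∧ ∃ a, (a, n) ∈ Q)
    (hfin.image _) (by
      intro n Q hfin hQ
      by_cases hn : n ∈ X.vertexSet
      · obtain ⟨Q₁, hs₁, hfin₁, hQ₁, b, hb⟩ := hQ.exists_extend_fst hX hfin hn
        obtain ⟨Q₂, hs₂, hfin₂, hQ₂, ha⟩ := hQ₁.exists_extend_snd hX hfin₁ hn
        exact ⟨Q₂, hs₁.trans hs₂, hfin₂, hQ₂, fun _ => ⟨⟨b, hs₂ hb⟩, ha⟩⟩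
      · exact ⟨Q, subset_rfl, hfin, hQ, fun h => absurd h hn⟩)
  have hdom : ∀ a ∈ X.vertexSet, ∃ b, (a, b) ∈ P := by
    intro a ha
    obtain ⟨Q, hQP, hQ⟩ := hreq a
    exact (hQ ha).1.imp fun b hb => hQP hb
  have hran : Prod.snd '' P = X.vertexSet := by
    ext b
    constructor
    · rintro ⟨x, hx, rfl⟩
      exact hP.snd_mem x hx
    · intro hb
      obtain ⟨Q, hQP, hQ⟩ := hreq b
      obtain ⟨a, ha⟩ := (hQ hb).2
      exact ⟨_, hQP ha, rfl⟩
  choose! F hF using hdom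
  have hiso := hP.isIso_of_graph hF
  have hself : X.induced X.vertexSet = X := by
    have : (X.induced X.vertexSet).faces = X.faces :=
      Set.ext fun s => and_iff_left_of_imp fun hs a ha => mem_vertexSet_of_mem hs ha
    cases X
    simpa [induced] using this
  rw [hran, hself] at hiso
  exact ⟨F, hiso, fun a ha =>
    (hP.fst_eq_iff _ (hF a (hU ha)) _ (hfP (Set.mem_image_of_mem _ ha))).1 rfl⟩

end SComplex

/-- Deleting from a Rado complex all simplexes containing some member
of a finite set `S` of simplexes again yields a Rado complex. -/
theorem rado_delete (X : SComplex) (hX : X.IsRado)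
    (S : Set (Finset ℕ)) (hSfin : S.Finite) (hSsub : S ⊆ X.faces) :
    (X.delete S).IsRado := by
  have hample := hX.ampleProp.delete hSfin hSsub
  exact ⟨Set.to_countable _, hample.universal, hample.homogeneous⟩
end

section
/- The geometric realization |X| of a Rado complex X, equipped with the weak topology, is contractible. -/
/-- A point of the geometric realisation of `X`: a function `α : ℕ → ℝ` with values
in `[0,1]`, whose support is (the vertex set of) a simplex of `X`, and whose values sum
to `1`. -/
def IsRealizationPoint (X : SComplex) (α : ℕ → ℝ) : Prop :=
  (∀ v, α v ∈ Set.Icc (0 : ℝ) 1) ∧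
    ∃ s ∈ X.faces, Function.support α = ↑s ∧ ∑ v ∈ s, α v = 1

/-- The geometric realisation `|X|` (as a set of functions). -/
def GeomReal (X : SComplex) : Type := {α : ℕ → ℝ // IsRealizationPoint X α}

/-- The closed cell `|σ|` of a simplex `σ`: all points of `|X|` supported in `σ`. -/
def Cell (X : SComplex) (σ : Finset ℕ) : Type :=
  {α : GeomReal X // Function.support α.1 ⊆ (↑σ : Set ℕ)}

/-- Each cell `|σ|` carries the (Euclidean) topology induced from the product
topology on `ℕ → ℝ`. -/
def cellTopology (X : SComplex) (σ : Finset ℕ) : TopologicalSpace (Cell X σ) :=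
  TopologicalSpace.induced (fun p => (p.1.1 : ℕ → ℝ)) inferInstance

/-- The weak topology on `|X|`: a set is open iff its trace on each cell `|σ|`,
`σ ∈ F(X)`, is open; equivalently, it is the final topology for the inclusions of
all cells. -/
def weakTopology (X : SComplex) : TopologicalSpace (GeomReal X) :=
  ⨆ σ ∈ X.faces,
    TopologicalSpace.coinduced (fun p : Cell X σ => p.1) (cellTopology X σ)

namespace SComplex

/-- The cone with apex `w` over the subcomplex of `X` induced on `U`. -/
def inducedCone (X : SComplex) (U : Finset ℕ) (w : ℕ) : SComplex where
  faces := {s | s.Nonempty ∧ (s.erase w = ∅ ∨ (s.erase w ∈ X.faces ∧ s.erase w ⊆ U))}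
  nonempty_of_mem := fun _ hs => hs.1
  down_closed := by
    rintro s ⟨-, hs⟩ t hts ht
    refine ⟨ht, ?_⟩
    have hsub : t.erase w ⊆ s.erase w := Finset.erase_subset_erase w hts
    rcases (t.erase w).eq_empty_or_nonempty with h | h
    · exact Or.inl h
    · rcases hs with hs | hs
      · rw [hs] at hsub
        exact Or.inl (Finset.subset_empty.mp hsub)
      · exact Or.inr ⟨X.down_closed _ hs.1 _ hsub h, hsub.trans hs.2⟩

/-- Every finite set of vertices of a universal homogeneous complex is the base of a cone. -/
theorem Universal.exists_cone_vertex_of_subset {X : SComplex} (hu : Universal X)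
    (hh : Homogeneous X) (U : Finset ℕ) (hU : (U : Set ℕ) ⊆ X.vertexSet) :
    ∃ v ∈ X.vertexSet, v ∉ U ∧ ∀ s ∈ X.faces, s ⊆ U → insert v s ∈ X.faces := by
  obtain ⟨w, hw⟩ := Infinite.exists_notMem_finset U
  set Y := X.inducedCone U w
  have hwY : w ∈ Y.vertexSet := by
    change {w} ∈ Y.faces
    exact ⟨by simp, by simp⟩
  have hUY : (U : Set ℕ) ⊆ Y.vertexSet := by
    intro u hu'
    have hne : u ≠ w := fun h => hw (h ▸ hu')
    change {u} ∈ Y.faces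
    refine ⟨by simp, Or.inr ?_⟩
    rw [Finset.erase_eq_of_notMem (by simpa using hne.symm)]
    exact ⟨hU hu', by simpa using hu'⟩
  obtain ⟨W, hWX, g, hg, hgf⟩ := hu Y (Set.to_countable _)
  have hgW : ∀ v ∈ Y.vertexSet, g v ∈ W := fun v hv => by
    have := (hg.mapsTo hv).2
    simpa using this
  have hvU : (X.induced U).vertexSet = U := by
    ext u
    refine ⟨fun h => by simpa using h.2, fun h => ⟨hU h, by simpa using h⟩⟩
  have hU'X : g '' U ⊆ X.vertexSet := by
    rintro _ ⟨u, hu', rfl⟩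
    exact hWX (hgW u (hUY hu'))
  have hvU' : (X.induced (g '' U)).vertexSet = g '' U := by
    ext u
    exact ⟨fun h => by simpa using h.2, fun h => ⟨hU'X h, by simpa using h⟩⟩
  have hiso : IsIso (X.induced U) (X.induced (g '' U)) g := by
    refine ⟨?_, ?_⟩
    · rw [hvU, hvU']
      exact (hg.injOn.mono hUY).bijOn_image
    · intro s hs
      rw [hvU] at hs
      have hws : w ∉ s := fun h => hw (hs h)
      have key := hgf s (hs.trans hUY)
      have h1 : s ∈ (X.induced U).faces ↔ s ∈ Y.faces := by
        change (s ∈ X.faces ∧ _) ↔ (s.Nonempty ∧ _)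
        rw [Finset.erase_eq_of_notMem hws]
        constructor
        · rintro ⟨h, -⟩
          exact ⟨X.nonempty_of_mem s h, Or.inr ⟨h, hs⟩⟩
        · rintro ⟨h, h' | h'⟩
          · exact absurd h' h.ne_empty
          · exact ⟨h'.1, hs⟩
      have h2 : s.image g ∈ (X.induced W).faces ↔ s.image g ∈ (X.induced (g '' U)).faces := by
        refine and_congr_right fun _ => ?_
        rw [Finset.coe_image]
        refine iff_of_true ?_ (Set.image_mono hs)
        rintro _ ⟨u, hu', rfl⟩
        exact hgW u (hUY (hs hu'))
      rw [h1, key, h2]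
  obtain ⟨F, ⟨hF, hFf⟩, hFg⟩ :=
    hh U (g '' U) U.finite_toSet (U.finite_toSet.image g) hU hU'X g hiso
  obtain ⟨v, hv, hvw⟩ := hF.surjOn (hWX (hgW w hwY))
  refine ⟨v, hv, ?_, ?_⟩
  · intro hvU
    rw [hFg hvU] at hvw
    exact hw (hg.injOn (hUY hvU) hwY hvw ▸ hvU)
  · intro s hs hsU
    have hws : w ∉ s := fun h => hw (hsU h)
    have hsUs : (s : Set ℕ) ⊆ U := fun x hx => hsU hx
    have hcone : insert w s ∈ Y.faces := by
      refine ⟨by simp, Or.inr ?_⟩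
      rw [Finset.erase_insert hws]
      exact ⟨hs, hsU⟩
    have himg : (insert v s).image F = (insert w s).image g := by
      rw [Finset.image_insert, Finset.image_insert, hvw]
      congr 1
      exact Finset.image_congr (hFg.mono hsUs)
    rw [hFf _ (by
      rw [Finset.coe_insert]
      exact Set.insert_subset hv (hsUs.trans hU)), himg]
    refine ((hgf _ ?_).mp hcone).1
    rw [Finset.coe_insert]
    exact Set.insert_subset hwY (hsUs.trans hUY)

/-- The simplexes of `X` together with the empty set. -/
def augmentedFaces (X : SComplex) : Set (Finset ℕ) := {s | s = ∅ ∨ s ∈ X.faces}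

theorem Universal.exists_cone_vertex {X : SComplex} (hu : Universal X) (hh : Homogeneous X)
    (U : Finset ℕ) :
    ∃ v, v ∉ U ∧ ∀ s ∈ X.augmentedFaces, s ⊆ U → insert v s ∈ X.faces := by
  classical
  obtain ⟨v, hv, hvU, h⟩ := hu.exists_cone_vertex_of_subset hh (U.filter (· ∈ X.vertexSet))
    (fun x hx => (Finset.mem_filter.mp hx).2)
  refine ⟨v, fun h' => hvU (Finset.mem_filter.mpr ⟨h', hv⟩), ?_⟩
  rintro s (rfl | hs) hsU
  · exact hv
  · exact h s hs fun x hx => Finset.mem_filter.mpr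
      ⟨hsU hx, X.down_closed s hs _ (by simpa using hx) (by simp)⟩

/-- A sequence of vertices, the `n`-th of which spans a cone over all simplexes made of the
first `n + 1` natural numbers and the earlier terms of the sequence. -/
theorem Universal.exists_cone_sequence {X : SComplex} (hu : Universal X) (hh : Homogeneous X) :
    ∃ c : ℕ → ℕ, Function.Injective c ∧
      ∀ (s t : Finset ℕ), s ∈ X.augmentedFaces → (∀ x ∈ s, ∀ n ∈ t, x ≤ n) →
        s ∪ t.image c ∈ X.augmentedFaces := by
  choose cone hcone hface using hu.exists_cone_vertex hh
  let U : ℕ → Finset ℕ := fun n =>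
    Nat.rec {0} (fun k V => insert (k + 1) (insert (cone V) V)) n
  have hsucc : ∀ n, U (n + 1) = insert (n + 1) (insert (cone (U n)) (U n)) := fun _ => rfl
  have hmono : Monotone U := monotone_nat_of_le_succ fun n => by
    rw [hsucc]
    exact (Finset.subset_insert _ _).trans (Finset.subset_insert _ _)
  have hself : ∀ n, n ∈ U n := by
    rintro (_ | n)
    · simp [U]
    · rw [hsucc]
      exact Finset.mem_insert_self _ _
  have hlt : ∀ m n, m < n → cone (U m) ∈ U n := fun m n hmn => by
    refine hmono (Nat.succ_le_of_lt hmn) ?_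
    rw [Nat.succ_eq_add_one, hsucc]
    simp
  refine ⟨fun n => cone (U n), ?_, ?_⟩
  · intro m n hmn
    by_contra hne
    change cone (U m) = cone (U n) at hmn
    rcases lt_or_gt_of_ne hne with h | h
    · exact hcone (U n) (hmn ▸ hlt m n h)
    · exact hcone (U m) (hmn.symm ▸ hlt n m h)
  · intro s t hs
    induction t using Finset.induction_on_max with
    | empty => simpa using hs
    | insert a t hat ih =>
      intro hst
      have ih' := ih fun x hx n hn => hst x hx n (Finset.mem_insert_of_mem hn)
      rw [Finset.image_insert, Finset.union_insert]
      refine Or.inr (hface _ _ ih' ?_)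
      refine Finset.union_subset ?_ ?_
      · exact fun x hx => hmono (hst x hx a (Finset.mem_insert_self _ _)) (hself x)
      · intro x hx
        obtain ⟨n, hn, rfl⟩ := Finset.mem_image.mp hx
        exact hlt n a (hat n hn)

end SComplex

namespace GeomReal

open SComplex unitInterval

attribute [local instance] weakTopology cellTopology

variable {X : SComplex}

/-- The simplex carrying a point of the realisation in its interior. -/
theorem exists_face (α : GeomReal X) :
    ∃ s ∈ X.faces, Function.support α.1 = ↑s ∧ ∑ v ∈ s, α.1 v = 1 := α.2.2

theorem nonneg (α : GeomReal X) (v : ℕ) : 0 ≤ α.1 v := (α.2.1 v).1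

theorem sum_eq_one (α : GeomReal X) {s : Finset ℕ} (hs : Function.support α.1 ⊆ ↑s) :
    ∑ v ∈ s, α.1 v = 1 := by
  obtain ⟨t, -, ht, hsum⟩ := α.exists_face
  rw [← hsum]
  symm
  refine Finset.sum_subset (fun x hx => hs (ht ▸ hx)) fun x _ hx => ?_
  by_contra h
  exact hx (by have : x ∈ Function.support α.1 := h
               rwa [ht] at this)

theorem isRealizationPoint_of_subset {β : ℕ → ℝ} {s : Finset ℕ} (hs : s ∈ X.augmentedFaces)
    (h0 : ∀ v, 0 ≤ β v) (hsupp : Function.support β ⊆ ↑s) (hsum : ∑ v ∈ s, β v = 1) :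
    IsRealizationPoint X β := by
  classical
  have hle : ∀ v, β v ≤ 1 := fun v => by
    by_cases hv : v ∈ s
    · exact hsum ▸ Finset.single_le_sum (fun i _ => h0 i) hv
    · have : β v = 0 := by
        by_contra h
        exact hv (hsupp h)
      rw [this]
      exact zero_le_one
  have hsum' : ∑ v ∈ s.filter (β · ≠ 0), β v = 1 := by rw [Finset.sum_filter_ne_zero, hsum]
  have hne : (s.filter (β · ≠ 0)).Nonempty := by
    by_contra h
    rw [Finset.not_nonempty_iff_eq_empty.mp h] at hsum'
    simp at hsum'
  rcases hs with rfl | hs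
  · simp at hsum
  refine ⟨fun v => ⟨h0 v, hle v⟩, s.filter (β · ≠ 0),
    X.down_closed s hs _ (Finset.filter_subset _ _) hne, ?_, hsum'⟩
  ext v
  simp only [Function.mem_support, Finset.coe_filter, Set.mem_ofPred_eq]
  exact ⟨fun h => ⟨hsupp h, h⟩, fun h => h.2⟩

theorem continuous_cell_val {s : Finset ℕ} (hs : s ∈ X.faces) :
    Continuous (fun p : Cell X s => p.1) := by
  rw [continuous_iff_coinduced_le]
  exact le_iSup₂_of_le (f := fun t (_ : t ∈ X.faces) =>
    TopologicalSpace.coinduced (fun p : Cell X t => p.1) (cellTopology X t)) s hs le_rfl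

theorem continuous_cell_coord (s : Finset ℕ) (v : ℕ) :
    Continuous (fun p : Cell X s => p.1.1 v) :=
  (continuous_apply v).comp continuous_induced_dom

theorem continuous_of_cells {Z : Type*} [TopologicalSpace Z] {f : GeomReal X → Z}
    (h : ∀ s ∈ X.faces, Continuous (fun p : Cell X s => f p.1)) : Continuous f := by
  refine continuous_iSup_dom.mpr fun s => continuous_iSup_dom.mpr fun hs => ?_
  exact continuous_coinduced_dom.mpr (h s hs)

/-- A map into a finite subcomplex is continuous as soon as its coordinates are. -/
theorem continuous_of_coord {Z : Type*} [TopologicalSpace Z] {f : Z → GeomReal X} (W : Finset ℕ)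
    (hW : ∀ z, Function.support (f z).1 ⊆ ↑W) (hf : ∀ v, Continuous fun z => (f z).1 v) :
    Continuous f := by
  classical
  let C : {s : Finset ℕ // s ∈ W.powerset.filter (· ∈ X.faces)} → Set Z :=
    fun s => {z | Function.support (f z).1 ⊆ ↑s.1}
  have hC : ∀ s, C s = ⋂ v ∈ (s.1 : Set ℕ)ᶜ, {z | (f z).1 v = 0} := by
    intro s
    ext z
    simp only [C, Set.mem_ofPred_eq, Set.mem_iInter, Function.support_subset_iff']
    rfl
  refine LocallyFinite.continuous (locallyFinite_of_finite C) ?_ ?_ ?_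
  · refine Set.eq_univ_of_forall fun z => ?_
    obtain ⟨s, hs, hsupp, -⟩ := (f z).exists_face
    refine Set.mem_iUnion.mpr
      ⟨⟨s, Finset.mem_filter.mpr ⟨Finset.mem_powerset.mpr ?_, hs⟩⟩, hsupp.le⟩
    exact Finset.coe_subset.mp (hsupp ▸ hW z)
  · intro s
    rw [hC]
    exact isClosed_biInter fun v _ => isClosed_eq (hf v) continuous_const
  · intro s
    rw [continuousOn_iff_continuous_domRestrict]
    let F : C s → Cell X s.1 := fun z => ⟨f z.1, z.2⟩
    have hcell : Continuous F :=
      continuous_induced_rng.mpr (continuous_pi fun v => (hf v).comp continuous_subtype_val)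
    exact (continuous_cell_val (Finset.mem_filter.mp s.2).2).comp hcell

/-- A self-map of `|X|` which sends each cell to a finite subcomplex, continuously in each
coordinate. -/
def Tame (p : GeomReal X → GeomReal X) : Prop :=
  ∀ s ∈ X.faces, (∃ W : Finset ℕ, ∀ α : Cell X s, Function.support (p α.1).1 ⊆ ↑W) ∧
    ∀ v, Continuous fun α : Cell X s => (p α.1).1 v

theorem Tame.continuous {p : GeomReal X → GeomReal X} (hp : Tame p) : Continuous p :=
  continuous_of_cells fun s hs =>
    let ⟨⟨W, hW⟩, hc⟩ := hp s hs
    continuous_of_coord W hW hc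

theorem tame_id : Tame (id : GeomReal X → GeomReal X) := fun s _ =>
  ⟨⟨s, fun α => α.2⟩, continuous_cell_coord s⟩

theorem tame_const (β : GeomReal X) : Tame fun _ : GeomReal X => β := fun _ _ =>
  let ⟨t, _, ht, _⟩ := β.exists_face
  ⟨⟨t, fun _ => ht.le⟩, fun _ => continuous_const⟩

theorem support_lineMap_subset (x y : ℕ → ℝ) (t : ℝ) (W : Set ℕ)
    (hx : Function.support x ⊆ W) (hy : Function.support y ⊆ W) :
    Function.support (fun v => (1 - t) * x v + t * y v) ⊆ W := by
  rw [Function.support_subset_iff'] at hx hy ⊢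
  intro v hv
  simp [hx v hv, hy v hv]

theorem isRealizationPoint_segment (α β : GeomReal X) (t : I) {s : Finset ℕ}
    (hs : s ∈ X.augmentedFaces)
    (hα : Function.support α.1 ⊆ ↑s) (hβ : Function.support β.1 ⊆ ↑s) :
    IsRealizationPoint X fun v => (1 - (t : ℝ)) * α.1 v + t * β.1 v := by
  refine isRealizationPoint_of_subset hs (fun v => ?_) (support_lineMap_subset _ _ _ _ hα hβ) ?_
  · exact add_nonneg (mul_nonneg (sub_nonneg.mpr t.2.2) (α.nonneg v))
      (mul_nonneg t.2.1 (β.nonneg v))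
  · rw [Finset.sum_add_distrib, ← Finset.mul_sum, ← Finset.mul_sum, α.sum_eq_one hα,
      β.sum_eq_one hβ]
    ring

/-- Contiguous tame maps are homotopic along straight segments. -/
theorem Tame.homotopic {p q : GeomReal X → GeomReal X} (hp : Tame p) (hq : Tame q)
    (h : ∀ α, ∃ s ∈ X.augmentedFaces,
      Function.support (p α).1 ⊆ ↑s ∧ Function.support (q α).1 ⊆ ↑s) :
    ContinuousMap.Homotopic ⟨p, hp.continuous⟩ ⟨q, hq.continuous⟩ := by
  let H : GeomReal X → I → GeomReal X := fun α t =>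
    ⟨fun v => (1 - (t : ℝ)) * (p α).1 v + t * (q α).1 v,
      let ⟨_, hs, h1, h2⟩ := h α
      isRealizationPoint_segment _ _ t hs h1 h2⟩
  have hcell : ∀ s ∈ X.faces, Continuous fun z : Cell X s × I => H z.1.1 z.2 := by
    intro s hs
    obtain ⟨⟨W, hW⟩, hpc⟩ := hp s hs
    obtain ⟨⟨W', hW'⟩, hqc⟩ := hq s hs
    refine continuous_of_coord (W ∪ W') (fun z => ?_) fun v => ?_
    · refine support_lineMap_subset _ _ _ _ ((hW z.1).trans ?_) ((hW' z.1).trans ?_) <;> simp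
    · have h1 := (hpc v).comp (continuous_fst (X := Cell X s) (Y := I))
      have h2 := (hqc v).comp (continuous_fst (X := Cell X s) (Y := I))
      have h3 : Continuous fun z : Cell X s × I => (z.2 : ℝ) :=
        continuous_subtype_val.comp continuous_snd
      exact ((continuous_const.sub h3).mul h1).add (h3.mul h2)
  have hpath : ∀ α, Continuous (H α) := fun α => by
    obtain ⟨s, hs, hsupp, -⟩ := α.exists_face
    let a : Cell X s := ⟨α, hsupp.le⟩
    exact (hcell s hs).comp (Continuous.prodMk_right a)
  let K : GeomReal X → C(I, GeomReal X) := fun α => ⟨H α, hpath α⟩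
  have hK : Continuous K := continuous_of_cells fun s hs =>
    (ContinuousMap.curry ⟨_, hcell s hs⟩).continuous
  have hH : Continuous fun z : GeomReal X × I => H z.1 z.2 :=
    ContinuousMap.continuous_uncurry_of_continuous ⟨K, hK⟩
  refine ⟨⟨⟨fun z => H z.2 z.1, hH.comp continuous_swap⟩, fun α => ?_, fun α => ?_⟩⟩
  · exact Subtype.ext (funext fun v => by simp [H])
  · exact Subtype.ext (funext fun v => by simp [H])

/-- The measure on `ℕ` whose distribution function is `φ` applied to that of `α`. -/
def redistribute (φ : ℝ → ℝ) (α : ℕ → ℝ) (v : ℕ) : ℝ :=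
  φ (∑ i ∈ Finset.range (v + 1), α i) - φ (∑ i ∈ Finset.range v, α i)

theorem support_redistribute_subset (φ : ℝ → ℝ) (α : ℕ → ℝ) :
    Function.support (redistribute φ α) ⊆ Function.support α := by
  intro v hv h0
  exact hv (by rw [redistribute, Finset.sum_range_succ, h0, add_zero, sub_self])

theorem redistribute_nonneg {φ : ℝ → ℝ} (hφ : Monotone φ) (α : GeomReal X) (v : ℕ) :
    0 ≤ redistribute φ α.1 v := by
  refine sub_nonneg.mpr (hφ ?_)
  rw [Finset.sum_range_succ]
  exact le_add_of_nonneg_right (α.nonneg v)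

theorem sum_redistribute {φ : ℝ → ℝ} (h0 : φ 0 = 0) (h1 : φ 1 = 1) (α : GeomReal X)
    {s : Finset ℕ} (hs : Function.support α.1 ⊆ ↑s) :
    ∑ v ∈ s, redistribute φ α.1 v = 1 := by
  obtain ⟨N, hN⟩ := s.exists_nat_subset_range
  rw [Finset.sum_subset hN fun v _ hv => ?_]
  · have := Finset.sum_range_sub (fun n => φ (∑ i ∈ Finset.range n, α.1 i)) N
    simp only [redistribute, this, Finset.range_zero, Finset.sum_empty, h0, sub_zero]
    rw [α.sum_eq_one (hs.trans (Finset.coe_subset.mpr hN)), h1]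
  · by_contra h
    exact hv (hs (support_redistribute_subset φ α.1 h))

theorem continuous_redistribute {φ : ℝ → ℝ} (hφ : Continuous φ) (s : Finset ℕ) (v : ℕ) :
    Continuous fun α : Cell X s => redistribute φ α.1.1 v :=
  (hφ.comp (continuous_finsetSum _ fun i _ => continuous_cell_coord s i)).sub
    (hφ.comp (continuous_finsetSum _ fun i _ => continuous_cell_coord s i))

theorem isRealizationPoint_redistribute {φ : ℝ → ℝ} (hφ : Monotone φ) (h0 : φ 0 = 0)
    (h1 : φ 1 = 1) (α : GeomReal X) : IsRealizationPoint X (redistribute φ α.1) := by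
  obtain ⟨s, hs, hsupp, -⟩ := α.exists_face
  exact isRealizationPoint_of_subset (Or.inr hs) (redistribute_nonneg hφ α)
    ((support_redistribute_subset φ α.1).trans hsupp.le) (sum_redistribute h0 h1 α hsupp.le)

theorem support_extend_subset {c : ℕ → ℕ} (β : ℕ → ℝ) {s : Finset ℕ}
    (hs : Function.support β ⊆ ↑s) :
    Function.support (Function.extend c β (0 : ℕ → ℝ)) ⊆ ↑(s.image c) := by
  intro x hx
  by_cases h : ∃ n, c n = x
  · classical
    rw [Function.mem_support, Function.extend_def, dif_pos h] at hx
    exact Finset.mem_coe.mpr (Finset.mem_image.mpr ⟨_, hs hx, h.choose_spec⟩)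
  · exact absurd (Function.extend_apply' β (0 : ℕ → ℝ) x h) hx

theorem extend_nonneg {c : ℕ → ℕ} {β : ℕ → ℝ} (hβ : ∀ v, 0 ≤ β v) (x : ℕ) :
    0 ≤ Function.extend c β (0 : ℕ → ℝ) x := by
  classical
  rw [Function.extend_def]
  split_ifs
  · exact hβ _
  · exact le_rfl

theorem sum_extend {c : ℕ → ℕ} (hc : Function.Injective c) (β : ℕ → ℝ) (s : Finset ℕ) :
    ∑ x ∈ s.image c, Function.extend c β (0 : ℕ → ℝ) x = ∑ v ∈ s, β v := by
  rw [Finset.sum_image hc.injOn]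
  exact Finset.sum_congr rfl fun v _ => hc.extend_apply β 0 v

theorem continuous_extend {Z : Type*} [TopologicalSpace Z] {c : ℕ → ℕ} {β : Z → ℕ → ℝ}
    (hβ : ∀ v, Continuous fun z => β z v) (x : ℕ) :
    Continuous fun z => Function.extend c (β z) (0 : ℕ → ℝ) x := by
  classical
  simp only [Function.extend_def]
  split_ifs
  · exact hβ _
  · exact continuous_const

/-- The mass of `α` below the median, rescaled. -/
noncomputable def lowerHalf (α : ℕ → ℝ) : ℕ → ℝ := redistribute (fun x => min (2 * x) 1) α

/-- The mass of `α` above the median, rescaled. -/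
noncomputable def upperHalf (α : ℕ → ℝ) : ℕ → ℝ := redistribute (fun x => max (2 * x - 1) 0) α

theorem le_of_mem_support_halves (α : GeomReal X) {v n : ℕ}
    (hv : v ∈ Function.support (lowerHalf α.1)) (hn : n ∈ Function.support (upperHalf α.1)) :
    v ≤ n := by
  have hmono : Monotone fun n => ∑ i ∈ Finset.range n, α.1 i :=
    monotone_nat_of_le_succ fun n => by
      rw [Finset.sum_range_succ]
      exact le_add_of_nonneg_right (α.nonneg n)
  by_contra! hlt
  have h1 : ∑ i ∈ Finset.range (n + 1), α.1 i ≤ ∑ i ∈ Finset.range v, α.1 i := hmono hlt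
  have h2 : ∑ i ∈ Finset.range n, α.1 i ≤ ∑ i ∈ Finset.range (n + 1), α.1 i :=
    hmono n.le_succ
  have h3 : ∑ i ∈ Finset.range v, α.1 i ≤ ∑ i ∈ Finset.range (v + 1), α.1 i :=
    hmono v.le_succ
  rcases le_total (∑ i ∈ Finset.range v, α.1 i) (1 / 2) with h | h
  · refine hn ?_
    rw [upperHalf, redistribute, max_eq_right (by linarith), max_eq_right (by linarith), sub_self]
  · refine hv ?_
    rw [lowerHalf, redistribute, min_eq_right (by linarith), min_eq_right (by linarith), sub_self]

theorem contractibleSpace_of_cone_sequence (c : ℕ → ℕ) (hc : Function.Injective c)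
    (hface : ∀ (s t : Finset ℕ), s ∈ X.augmentedFaces → (∀ x ∈ s, ∀ n ∈ t, x ≤ n) →
      s ∪ t.image c ∈ X.augmentedFaces) :
    ContractibleSpace (GeomReal X) := by
  have himage : ∀ t : Finset ℕ, t.image c ∈ X.augmentedFaces := fun t => by
    simpa using hface ∅ t (Or.inl rfl) (by simp)
  have hlow_mono : Monotone fun x : ℝ => min (2 * x) 1 := fun x y h =>
    min_le_min_right 1 (by linarith)
  have hup_mono : Monotone fun x : ℝ => max (2 * x - 1) 0 := fun x y h =>
    max_le_max_right 0 (by linarith)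
  have hup_supp : ∀ (α : GeomReal X) (s : Finset ℕ), Function.support α.1 ⊆ ↑s →
      Function.support (upperHalf α.1) ⊆ ↑s := fun α s hs =>
    (support_redistribute_subset _ α.1).trans hs
  let p : GeomReal X → GeomReal X := fun α =>
    ⟨lowerHalf α.1, isRealizationPoint_redistribute hlow_mono (by simp) (by norm_num) α⟩
  have hp_supp : ∀ α, Function.support (p α).1 ⊆ Function.support α.1 := fun α =>
    support_redistribute_subset (fun x => min (2 * x) 1) α.1
  let q : GeomReal X → GeomReal X := fun α => ⟨Function.extend c (upperHalf α.1) (0 : ℕ → ℝ), by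
    obtain ⟨s, -, hs, -⟩ := α.exists_face
    refine isRealizationPoint_of_subset (himage s) (extend_nonneg (redistribute_nonneg hup_mono α))
      (support_extend_subset _ (hup_supp α s hs.le)) ?_
    rw [sum_extend hc]
    exact sum_redistribute (by simp) (by norm_num) α hs.le⟩
  let b : GeomReal X := ⟨Pi.single (c 0) 1, by
    refine isRealizationPoint_of_subset (himage {0}) (fun v => ?_) (by simp) (by simp)
    exact (Pi.single_nonneg.mpr zero_le_one : (0 : ℕ → ℝ) ≤ _) v⟩
  have hp : Tame p := fun s _ =>
    ⟨⟨s, fun α => (hp_supp α.1).trans α.2⟩,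
      continuous_redistribute (φ := fun x => min (2 * x) 1) (by fun_prop) s⟩
  have hq : Tame q := fun s _ =>
    ⟨⟨s.image c, fun α => support_extend_subset _ (hup_supp α.1 s α.2)⟩,
      continuous_extend
        (continuous_redistribute (φ := fun x => max (2 * x - 1) 0) (by fun_prop) s)⟩
  have hb := tame_const b
  have h_id_p := tame_id.homotopic hp fun α => by
    obtain ⟨s, hs, hsupp, -⟩ := α.exists_face
    exact ⟨s, Or.inr hs, hsupp.le, (hp_supp α).trans hsupp.le⟩
  have h_p_q := hp.homotopic hq fun α => by
    classical
    obtain ⟨s, hs, hsupp, -⟩ := (p α).exists_face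
    obtain ⟨r, -, hr, -⟩ := α.exists_face
    let t := r.filter (· ∈ Function.support (upperHalf α.1))
    have ht : Function.support (upperHalf α.1) ⊆ ↑t := fun x hx =>
      Finset.mem_coe.mpr (Finset.mem_filter.mpr ⟨hup_supp α r hr.le hx, hx⟩)
    refine ⟨s ∪ t.image c, hface s t (Or.inr hs) fun x hx n hn => ?_, ?_, ?_⟩
    · refine le_of_mem_support_halves α ?_ (Finset.mem_filter.mp hn).2
      exact hsupp.ge hx
    · exact hsupp.le.trans (by simp)
    · exact (support_extend_subset _ ht).trans (by simp)
  have h_q_b := hq.homotopic hb fun α => by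
    obtain ⟨s, -, hs, -⟩ := α.exists_face
    refine ⟨(insert 0 s).image c, himage _, support_extend_subset _ ?_, ?_⟩
    · exact (hup_supp α s hs.le).trans (by simp)
    · intro x hx
      have : x = c 0 := by
        by_contra h
        exact hx (Pi.single_eq_of_ne h 1)
      simp [this]
  rw [contractible_iff_id_nullhomotopic]
  exact ⟨b, (h_id_p.trans h_p_q).trans h_q_b⟩

end GeomReal

/-- The geometric realisation of a Rado complex, with the weak
topology, is contractible. -/
theorem rado_realization_contractible (X : SComplex) (hX : X.IsRado) :
    @ContractibleSpace (GeomReal X) (weakTopology X) := by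
  obtain ⟨c, hc, hface⟩ := hX.2.1.exists_cone_sequence hX.2.2
  exact GeomReal.contractibleSpace_of_cone_sequence c hc hface
end

section
/- Let L be a finite simplicial complex and suppose that with each simplex σ ∈ F(L) a real number p_σ ∈ [0,1] is associated; write q_σ = 1 − p_σ. For a subcomplex A ⊆ L (possibly empty), define p(A) = (∏_{σ ∈ F(A)} p_σ) · (∏_{σ ∈ E(A|L)} q_σ). Then the sum of p(A) over all subcomplexes A ⊆ L, including the empty subcomplex, equals 1. -/
/-- `A` (a set of finsets) is a subcomplex of `L`: a subset of the simplexes of `L`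
closed under passing to nonempty subsets.  (The empty subcomplex is allowed.) -/
def IsSubcomplexSet (A : Set (Finset ℕ)) (L : SComplex) : Prop :=
  A ⊆ L.faces ∧ ∀ s ∈ A, ∀ t ⊆ s, t.Nonempty → t ∈ A

/-- `E(A|L)`: the simplexes of `L` external for `A` in `L`, i.e. not in `A` but with
all proper nonempty faces in `A`. -/
def externalSet (A : Set (Finset ℕ)) (L : SComplex) : Set (Finset ℕ) :=
  {σ | σ ∈ L.faces ∧ σ ∉ A ∧ ∀ τ ⊂ σ, τ.Nonempty → τ ∈ A}

/-- All proper nonempty faces of `σ` lie in `A`. -/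
def BoundaryIn (A : Finset (Finset ℕ)) (σ : Finset ℕ) : Prop :=
  ∀ τ ⊂ σ, τ.Nonempty → τ ∈ A

/-- `A` is closed under passing to nonempty subsets. -/
def FaceClosed (A : Finset (Finset ℕ)) : Prop :=
  ∀ s ∈ A, ∀ t ⊆ s, t.Nonempty → t ∈ A

open Classical in
/-- The product of `p` over `A` and of `1 - p` over the members of `F` external for `A`. -/
noncomputable def subcomplexWeight (p : Finset ℕ → ℝ) (F A : Finset (Finset ℕ)) : ℝ :=
  (∏ σ ∈ A, p σ) * ∏ σ ∈ F with σ ∉ A ∧ BoundaryIn A σ, (1 - p σ)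

theorem boundaryIn_insert_iff {F A : Finset (Finset ℕ)} {a σ : Finset ℕ}
    (hmax : ∀ x ∈ F, x.card ≤ a.card) (hσ : σ ∈ F) :
    BoundaryIn (insert a A) σ ↔ BoundaryIn A σ := by
  refine forall₂_congr fun τ hτ => imp_congr_right fun _ => ?_
  have hne : τ ≠ a := by
    rintro rfl
    exact absurd (Finset.card_lt_card hτ) (hmax σ hσ).not_gt
  simp [hne]

theorem faceClosed_insert_iff {F A : Finset (Finset ℕ)} {a : Finset ℕ} (haF : a ∉ F)
    (hmax : ∀ x ∈ F, x.card ≤ a.card) (hA : A ⊆ F) :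
    FaceClosed (insert a A) ↔ FaceClosed A ∧ BoundaryIn A a := by
  constructor
  · intro h
    refine ⟨fun s hs t hts ht => ?_, fun t hta ht => ?_⟩
    · refine (Finset.mem_insert.1 (h s (Finset.mem_insert_of_mem hs) t hts ht)).resolve_left ?_
      rintro rfl
      exact haF (Finset.eq_of_subset_of_card_le hts (hmax s (hA hs)) ▸ hA hs)
    · exact (Finset.mem_insert.1
        (h a (Finset.mem_insert_self a A) t hta.subset ht)).resolve_left hta.ne
  · rintro ⟨h, hb⟩ s hs t hts ht
    rcases Finset.mem_insert.1 hs with rfl | hs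
    · rcases eq_or_ne t s with rfl | hne
      · exact Finset.mem_insert_self _ _
      · exact Finset.mem_insert_of_mem (hb t (hts.ssubset_of_ne hne) ht)
    · exact Finset.mem_insert_of_mem (h s hs t hts ht)

theorem subcomplexWeight_insert_left (p : Finset ℕ → ℝ) {F A : Finset (Finset ℕ)}
    {a : Finset ℕ} (haF : a ∉ F) (hA : A ⊆ F) [Decidable (BoundaryIn A a)] :
    subcomplexWeight p (insert a F) A =
      (if BoundaryIn A a then 1 - p a else 1) * subcomplexWeight p F A := by
  classical
  have haA : a ∉ A := fun h => haF (hA h)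
  unfold subcomplexWeight
  rw [Finset.filter_insert]
  by_cases hb : BoundaryIn A a
  · rw [if_pos ⟨haA, hb⟩, if_pos hb, Finset.prod_insert (by simp [haF])]
    ring
  · rw [if_neg (fun h => hb h.2), if_neg hb, one_mul]

theorem subcomplexWeight_insert_insert (p : Finset ℕ → ℝ) {F A : Finset (Finset ℕ)}
    {a : Finset ℕ} (haF : a ∉ F) (hmax : ∀ x ∈ F, x.card ≤ a.card) (hA : A ⊆ F) :
    subcomplexWeight p (insert a F) (insert a A) = p a * subcomplexWeight p F A := by
  classical
  have haA : a ∉ A := fun h => haF (hA h)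
  unfold subcomplexWeight
  rw [Finset.filter_insert, if_neg (by simp), Finset.prod_insert haA, mul_assoc]
  congr 3
  refine Finset.filter_congr fun σ hσ => ?_
  have hne : σ ≠ a := fun h => haF (h ▸ hσ)
  rw [boundaryIn_insert_iff hmax hσ]
  simp [hne]

open Classical in
/-- The weights of the face-closed subsets of any finite family of finite sets add up to `1`. -/
theorem sum_subcomplexWeight (p : Finset ℕ → ℝ) (F : Finset (Finset ℕ)) :
    ∑ A ∈ F.powerset, (if FaceClosed A then subcomplexWeight p F A else 0) = 1 := by
  refine Finset.induction_on_max_value Finset.card F ?_ fun a F haF hmax ih => ?_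
  · simp [FaceClosed, subcomplexWeight]
  · rw [Finset.sum_powerset_insert haF, ← Finset.sum_add_distrib, ← ih]
    refine Finset.sum_congr rfl fun A hA => ?_
    rw [Finset.mem_powerset] at hA
    rw [subcomplexWeight_insert_left p haF hA, subcomplexWeight_insert_insert p haF hmax hA,
      faceClosed_insert_iff haF hmax hA]
    by_cases hc : FaceClosed A <;> by_cases hb : BoundaryIn A a <;> simp [hc, hb]
    ring

theorem SComplex.finite_faces (L : SComplex) (hL : L.vertexSet.Finite) : L.faces.Finite := by
  refine hL.toFinset.powerset.finite_toSet.subset fun s hs => ?_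
  rw [Finset.mem_coe, Finset.mem_powerset]
  intro v hv
  rw [Set.Finite.mem_toFinset]
  exact L.down_closed s hs {v} (Finset.singleton_subset_iff.2 hv) (Finset.singleton_nonempty v)

/-- (Lemma 21 of the paper.) For a finite simplicial complex `L` with
probability parameters `p σ ∈ [0,1]` on its simplexes, the numbers
`p(A) = ∏_{σ ∈ F(A)} p σ · ∏_{σ ∈ E(A|L)} (1 - p σ)`, summed over all subcomplexes
`A ⊆ L` (including the empty one), add up to `1`. -/
theorem sum_over_subcomplexes_eq_one (L : SComplex) (hL : L.vertexSet.Finite)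
    (p : Finset ℕ → ℝ) (hp : ∀ σ ∈ L.faces, p σ ∈ Set.Icc (0 : ℝ) 1) :
    (∑ᶠ (A : Set (Finset ℕ)) (_ : IsSubcomplexSet A L),
      (∏ᶠ σ ∈ A, p σ) * ∏ᶠ σ ∈ externalSet A L, (1 - p σ)) = 1 := by
  classical
  obtain ⟨F, hF⟩ := (L.finite_faces hL).exists_finset_coe
  have hsub (A : Finset (Finset ℕ)) :
      IsSubcomplexSet (A : Set (Finset ℕ)) L ↔ A ∈ F.powerset ∧ FaceClosed A := by
    simp [IsSubcomplexSet, FaceClosed, ← hF]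
  have hweight (A : Finset (Finset ℕ)) :
      (∏ᶠ σ ∈ (A : Set (Finset ℕ)), p σ) * ∏ᶠ σ ∈ externalSet (A : Set (Finset ℕ)) L, (1 - p σ) =
        subcomplexWeight p F A := by
    have hext : externalSet (A : Set (Finset ℕ)) L =
        ({σ ∈ F | σ ∉ A ∧ BoundaryIn A σ} : Finset (Finset ℕ)) := by
      ext σ
      rw [Finset.mem_coe, Finset.mem_filter, ← Finset.mem_coe, hF]
      rfl
    rw [hext, finprod_mem_coe_finset, finprod_mem_coe_finset, subcomplexWeight]
  have hset : {A | IsSubcomplexSet A L} =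
      ((↑) : Finset (Finset ℕ) → Set (Finset ℕ)) '' ({A ∈ F.powerset | FaceClosed A} : Finset _) := by
    ext A
    constructor
    · intro hA
      obtain ⟨B, rfl⟩ := ((L.finite_faces hL).subset hA.1).exists_finset_coe
      exact ⟨B, Finset.mem_coe.2 (Finset.mem_filter.2 ((hsub B).1 hA)), rfl⟩
    · rintro ⟨B, hB, rfl⟩
      exact (hsub B).2 (Finset.mem_filter.1 (Finset.mem_coe.1 hB))
  change (∑ᶠ A ∈ {A | IsSubcomplexSet A L}, _) = 1
  rw [hset, finsum_mem_image Finset.coe_injective.injOn, finsum_mem_coe_finset,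
    Finset.sum_filter]
  refine Eq.trans ?_ (sum_subcomplexWeight p F)
  refine Finset.sum_congr rfl fun A _ => ?_
  split_ifs with hA
  · exact hweight A
  · rfl
end

section
/- Let Δ_ℕ be the simplex on the vertex set ℕ = {1, 2, …} (all nonempty finite subsets of ℕ are simplexes), let Ω be the set of all simplicial subcomplexes of Δ_ℕ, and let A' be the σ-algebra on Ω generated by the sets Z(Y, n) = {X ∈ Ω : X ∩ Δ_n = Y}, where n ranges over positive integers, Δ_n is the simplex spanned by {1, …, n}, and Y ranges over subcomplexes of Δ_n. Given any system of probability parameters p_σ ∈ [0,1], one for each simplex σ of Δ_ℕ (with q_σ = 1 − p_σ), there exists a probability measure μ on (Ω, A') satisfying μ(Z(Y, n)) = (∏_{σ ∈ F(Y)} p_σ) · (∏_{σ ∈ E(Y|Δ_n)} q_σ) for every n and every subcomplex Y ⊆ Δ_n. -/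
/-! Every `X : SComplex` is a subcomplex of the simplex `Δ_ℕ` on the vertex set `ℕ`;
thus `SComplex` itself plays the role of `Ω`, the set of all subcomplexes of `Δ_ℕ`. -/

/-- `X ∩ Δ_n`: the subcomplex of `X` induced on the first `n` vertices. -/
def SComplex.restrictTo (X : SComplex) (n : ℕ) : SComplex :=
  X.induced ↑(Finset.range n)

/-- `Y` is a subcomplex of `Δ_n`, the simplex spanned by the first `n` vertices. -/
def SComplex.On (Y : SComplex) (n : ℕ) : Prop := ∀ s ∈ Y.faces, s ⊆ Finset.range n

/-- The cylinder set `Z(Y, n) = {X ∈ Ω : X ∩ Δ_n = Y}`. -/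
def cylinder (Y : SComplex) (n : ℕ) : Set SComplex := {X | X.restrictTo n = Y}

/-- The σ-algebra `A'` on `Ω` generated by the cylinder sets. -/
instance cylinderSigmaAlgebra : MeasurableSpace SComplex :=
  MeasurableSpace.generateFrom {Z | ∃ n Y, SComplex.On Y n ∧ Z = cylinder Y n}

/-- `E(Y|Δ_n)`: the simplexes of `Δ_n` external for `Y` in `Δ_n`, i.e. the nonempty
subsets of the first `n` vertices which are not simplexes of `Y` but all of whose
proper nonempty subsets are simplexes of `Y`. -/
def externalIn (Y : SComplex) (n : ℕ) : Set (Finset ℕ) :=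
  {σ | σ ⊆ Finset.range n ∧ σ.Nonempty ∧ σ ∉ Y.faces ∧ ∀ τ ⊂ σ, τ.Nonempty → τ ∈ Y.faces}

open MeasureTheory

attribute [ext] SComplex

namespace SComplex

/-- The largest simplicial complex all of whose simplexes are marked `true` by `ω`. -/
def ofMarking (ω : Finset ℕ → Bool) : SComplex where
  faces := {s | s.Nonempty ∧ ∀ t ⊆ s, t.Nonempty → ω t = true}
  nonempty_of_mem := fun _ hs => hs.1
  down_closed := fun _ hs _ hts ht => ⟨ht, fun r hr => hs.2 r (hr.trans hts)⟩

theorem On.finite_faces {Y : SComplex} {n : ℕ} (hY : Y.On n) : Y.faces.Finite :=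
  (Finset.range n).powerset.finite_toSet.subset fun s hs =>
    Finset.mem_coe.mpr (Finset.mem_powerset.mpr (hY s hs))

theorem finite_externalIn (Y : SComplex) (n : ℕ) : (externalIn Y n).Finite :=
  (Finset.range n).powerset.finite_toSet.subset fun _ hs =>
    Finset.mem_coe.mpr (Finset.mem_powerset.mpr hs.1)

theorem disjoint_faces_externalIn (Y : SComplex) (n : ℕ) :
    Disjoint Y.faces (externalIn Y n) :=
  Set.disjoint_left.mpr fun _ hs hs' => hs'.2.2.1 hs

/-- A marking yields a complex in the cylinder of `Y` iff it marks the simplexes of `Y` by `true`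
and the external simplexes of `Y` by `false`. -/
theorem ofMarking_mem_cylinder {Y : SComplex} {n : ℕ} (hY : Y.On n) (ω : Finset ℕ → Bool) :
    ofMarking ω ∈ cylinder Y n ↔
      (∀ s ∈ Y.faces, ω s = true) ∧ ∀ s ∈ externalIn Y n, ω s = false := by
  have mem_restrict (s : Finset ℕ) : s ∈ ((ofMarking ω).restrictTo n).faces ↔
      (s.Nonempty ∧ ∀ t ⊆ s, t.Nonempty → ω t = true) ∧ s ⊆ Finset.range n := by
    simp only [restrictTo, induced, ofMarking, Set.mem_ofPred_eq, Finset.coe_subset]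
  constructor
  · intro h
    have hfaces (s : Finset ℕ) : s ∈ Y.faces ↔
        (s.Nonempty ∧ ∀ t ⊆ s, t.Nonempty → ω t = true) ∧ s ⊆ Finset.range n := by
      rw [← mem_restrict, show (ofMarking ω).restrictTo n = Y from h]
    have htrue (s : Finset ℕ) (hs : s ∈ Y.faces) : ω s = true :=
      ((hfaces s).mp hs).1.2 s subset_rfl (Y.nonempty_of_mem s hs)
    refine ⟨htrue, fun s ⟨hsn, hne, hs, hlt⟩ => ?_⟩
    by_contra hω
    refine hs ((hfaces s).mpr ⟨⟨hne, fun t hts ht => ?_⟩, hsn⟩)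
    rcases hts.eq_or_ssubset with rfl | hts
    · simpa using hω
    · exact htrue t (hlt t hts ht)
  · rintro ⟨htrue, hfalse⟩
    refine SComplex.ext (Set.ext fun s => ?_)
    rw [mem_restrict]
    constructor
    · induction s using Finset.strongInduction with
      | H s ih =>
        rintro ⟨⟨hne, hs⟩, hsn⟩
        by_contra hY'
        have hext : s ∈ externalIn Y n := ⟨hsn, hne, hY', fun t hts ht =>
          ih t hts ⟨⟨ht, fun r hr => hs r (hr.trans hts.subset)⟩, hts.subset.trans hsn⟩⟩
        simpa [hs s subset_rfl hne] using hfalse s hext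
    · exact fun hs => ⟨⟨Y.nonempty_of_mem s hs,
        fun t hts ht => htrue t (Y.down_closed s hs t hts ht)⟩, hY s hs⟩

open scoped Classical in
theorem preimage_ofMarking_cylinder {Y : SComplex} {n : ℕ} (hY : Y.On n) :
    ofMarking ⁻¹' cylinder Y n =
      Set.pi ↑(hY.finite_faces.toFinset ∪ (Y.finite_externalIn n).toFinset)
        fun s => {decide (s ∈ Y.faces)} := by
  ext ω
  rw [Set.mem_preimage, ofMarking_mem_cylinder hY]
  simp only [Finset.coe_union, Set.Finite.coe_toFinset, Set.union_pi, Set.mem_inter_iff,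
    Set.mem_pi, Set.mem_singleton_iff]
  refine and_congr (forall₂_congr fun s hs => by simp [hs])
    (forall₂_congr fun s hs => by simp [hs.2.2.1])

theorem measurable_ofMarking : Measurable ofMarking := by
  refine measurable_generateFrom ?_
  rintro _ ⟨n, Y, hY, rfl⟩
  classical
  rw [preimage_ofMarking_cylinder hY]
  exact MeasurableSet.pi (Finset.countable_toSet _) fun _ _ => MeasurableSet.singleton _

end SComplex

/-- The law on `Bool` giving mass `x` to `true` and mass `1 - x` to `false`. -/
noncomputable def boolLaw (x : ℝ) : Measure Bool :=
  ENNReal.ofReal x • Measure.dirac true + ENNReal.ofReal (1 - x) • Measure.dirac false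

theorem isProbabilityMeasure_boolLaw {x : ℝ} (hx : x ∈ Set.Icc (0 : ℝ) 1) :
    IsProbabilityMeasure (boolLaw x) :=
  ⟨by simp [boolLaw, ← ENNReal.ofReal_add hx.1 (sub_nonneg.mpr hx.2)]⟩

theorem boolLaw_singleton_true (x : ℝ) : boolLaw x {true} = ENNReal.ofReal x := by
  simp [boolLaw]

theorem boolLaw_singleton_false (x : ℝ) : boolLaw x {false} = ENNReal.ofReal (1 - x) := by
  simp [boolLaw]

theorem exists_random_complex_measure_of_forall_mem_Icc (p : Finset ℕ → ℝ)
    (hp : ∀ σ, p σ ∈ Set.Icc (0 : ℝ) 1) :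
    ∃ μ : Measure SComplex, IsProbabilityMeasure μ ∧
      ∀ (n : ℕ) (Y : SComplex), Y.On n →
        μ (cylinder Y n) =
          ENNReal.ofReal ((∏ᶠ σ ∈ Y.faces, p σ) * ∏ᶠ σ ∈ externalIn Y n, (1 - p σ)) := by
  classical
  have (σ : Finset ℕ) : IsProbabilityMeasure (boolLaw (p σ)) :=
    isProbabilityMeasure_boolLaw (hp σ)
  refine ⟨(Measure.infinitePi fun σ => boolLaw (p σ)).map SComplex.ofMarking,
    Measure.isProbabilityMeasure_map SComplex.measurable_ofMarking.aemeasurable,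
    fun n Y hY => ?_⟩
  have hmeas : MeasurableSet (cylinder Y n) :=
    MeasurableSpace.measurableSet_generateFrom ⟨n, Y, hY, rfl⟩
  rw [Measure.map_apply SComplex.measurable_ofMarking hmeas,
    SComplex.preimage_ofMarking_cylinder hY,
    Measure.infinitePi_pi _ fun _ _ => MeasurableSet.singleton _,
    Finset.prod_union (by simpa using Y.disjoint_faces_externalIn n),
    finprod_mem_eq_finite_toFinset_prod _ hY.finite_faces,
    finprod_mem_eq_finite_toFinset_prod _ (Y.finite_externalIn n),
    ENNReal.ofReal_mul (Finset.prod_nonneg fun σ _ => (hp σ).1),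
    ENNReal.ofReal_prod_of_nonneg fun σ _ => (hp σ).1,
    ENNReal.ofReal_prod_of_nonneg fun σ _ => sub_nonneg.mpr (hp σ).2]
  congr 1
  · refine Finset.prod_congr rfl fun σ hσ => ?_
    rw [Set.Finite.mem_toFinset] at hσ
    simp [hσ, boolLaw_singleton_true]
  · refine Finset.prod_congr rfl fun σ hσ => ?_
    rw [Set.Finite.mem_toFinset] at hσ
    simp [hσ.2.2.1, boolLaw_singleton_false]

/-- For any system of probability parameters `p σ ∈ [0,1]` indexed by
the simplexes of `Δ_ℕ`, there is a probability measure `μ` on `(Ω, A')` with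
`μ(Z(Y,n)) = ∏_{σ ∈ F(Y)} p σ · ∏_{σ ∈ E(Y|Δ_n)} (1 - p σ)` for every `n` and every
subcomplex `Y ⊆ Δ_n`. -/
theorem exists_random_complex_measure (p : Finset ℕ → ℝ)
    (hp : ∀ σ : Finset ℕ, σ.Nonempty → p σ ∈ Set.Icc (0 : ℝ) 1) :
    ∃ μ : MeasureTheory.Measure SComplex, MeasureTheory.IsProbabilityMeasure μ ∧
      ∀ (n : ℕ) (Y : SComplex), Y.On n →
        μ (cylinder Y n) =
          ENNReal.ofReal ((∏ᶠ σ ∈ Y.faces, p σ) * ∏ᶠ σ ∈ externalIn Y n, (1 - p σ)) := by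
  classical
  obtain ⟨μ, hμ, h⟩ := exists_random_complex_measure_of_forall_mem_Icc
    (fun σ => if σ.Nonempty then p σ else 0) fun σ => by
      split_ifs with hσ
      · exact hp σ hσ
      · simp
  refine ⟨μ, hμ, fun n Y hY => ?_⟩
  rw [h n Y hY,
    finprod_mem_congr rfl fun σ hσ => if_pos (Y.nonempty_of_mem σ hσ),
    finprod_mem_congr rfl fun σ (hσ : σ ∈ externalIn Y n) => by rw [if_pos hσ.2.1]]
end
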